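/- arXiv:2512.02641 — 2 statements merged into one kernel-verified Lean document; each statement's English description precedes it below -/
import Mathlib

section
/- Every d-decaying Gauss-like iterated function system satisfies Almost Tempered Distortion: for every ε > 0 there exists a function ρ : ℕ → [0,∞) with ρ(n)/n → 0 such that for all n ∈ ℕ, all ω = (a_1,…,a_n) ∈ ℕ^n, and all x, y ∈ [0,1], writing T_ω = T_{a_1}∘⋯∘T_{a_n}, one has | log|T_ω'(x)| − log|T_ω'(y)| | ≤ ρ(n) + ε·| log|T_ω'(x)| |. -/
open Set Filter Topology Metric MeasureTheory

noncomputable section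

/-- The composition `T_{a_1} ∘ ⋯ ∘ T_{a_n}` of the maps along the word `ω = (a_1,…,a_n)`. -/
def chainMap (T : ℕ+ → ℝ → ℝ) {n : ℕ} (ω : Fin n → ℕ+) (x : ℝ) : ℝ :=
  (List.ofFn ω).foldr (fun i y => T i y) x

/-- The chain-rule derivative of `chainMap T ω` at `x`, computed from the candidate
derivatives `T'` of the individual maps:
`(T_{a_1} ∘ ⋯ ∘ T_{a_n})'(x) = ∏_j T'_{a_j}(T_{a_{j+1}} ∘ ⋯ ∘ T_{a_n}(x))`. -/
def chainDeriv (T T' : ℕ+ → ℝ → ℝ) {n : ℕ} (ω : Fin n → ℕ+) (x : ℝ) : ℝ :=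
  ((List.ofFn ω).foldr (fun i p => (T i p.1, T' i p.1 * p.2)) (x, (1 : ℝ))).2

/-- A `d`-decaying Gauss-like iterated function system: a family `{T_i}_{i ≥ 1}` of
`C¹` self-maps of `[0,1]` (with derivative `T'`) satisfying the conditions (i)–(v). -/
structure GaussLikeIFS (d : ℝ) where
  one_lt_d : 1 < d
  T : ℕ+ → ℝ → ℝ
  T' : ℕ+ → ℝ → ℝ
  maps_to : ∀ i, Set.MapsTo (T i) (Set.Icc (0 : ℝ) 1) (Set.Icc (0 : ℝ) 1)
  hasDeriv : ∀ i, ∀ x ∈ Set.Icc (0 : ℝ) 1,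
    HasDerivWithinAt (T i) (T' i x) (Set.Icc (0 : ℝ) 1) x
  derivCont : ∀ i, ContinuousOn (T' i) (Set.Icc (0 : ℝ) 1)
  open_set_cond : ∀ i j : ℕ+, i ≠ j →
    T i '' Set.Ioo (0 : ℝ) 1 ∩ T j '' Set.Ioo (0 : ℝ) 1 = ∅
  covers : (⋃ i : ℕ+, T i '' Set.Icc (0 : ℝ) 1) = Set.Ico (0 : ℝ) 1
  ordered : ∀ i j : ℕ+, (∀ x ∈ Set.Ioo (0 : ℝ) 1, T i x < T j x) → i < j
  contracting : ∃ (m : ℕ) (h : ℝ), 0 < m ∧ 0 < h ∧ h < 1 ∧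
    ∀ (a : Fin m → ℕ+), ∀ x ∈ Set.Icc (0 : ℝ) 1,
      0 < |chainDeriv T T' a x| ∧ |chainDeriv T T' a x| ≤ h
  decay : ∀ ε : ℝ, 0 < ε → ∃ K₁ K₂ : ℝ, 0 < K₁ ∧ 0 < K₂ ∧
    ∀ i : ℕ+, ∃ ζ lam : ℝ,
      (∀ x ∈ Set.Icc (0 : ℝ) 1, ζ ≤ |T' i x| ∧ |T' i x| ≤ lam) ∧
      K₁ * ((i : ℕ) : ℝ) ^ (-(d + ε)) ≤ ζ ∧ ζ ≤ lam ∧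
      lam ≤ K₂ * ((i : ℕ) : ℝ) ^ (-(d - ε))

namespace GaussLikeIFS

variable {d : ℝ}

/-- The `n`-th level cylinder `C[ω] = T_{a_1} ∘ ⋯ ∘ T_{a_n}([0,1])`. -/
def cyl (S : GaussLikeIFS d) {n : ℕ} (ω : Fin n → ℕ+) : Set ℝ :=
  chainMap S.T ω '' Set.Icc 0 1

/-- The partition function `Z_n(s) = Σ_{ω ∈ ℕ^n} |C[ω]|^s`. -/
def Z (S : GaussLikeIFS d) (n : ℕ) (s : ℝ) : ℝ :=
  ∑' ω : Fin n → ℕ+, Metric.diam (S.cyl ω) ^ s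

/-- `P_n(s) = (1/n) log Z_n(s)`. -/
def Pn (S : GaussLikeIFS d) (n : ℕ) (s : ℝ) : ℝ :=
  (1 / (n : ℝ)) * Real.log (S.Z n s)

/-- The restricted partition function `Z_{M,n}(s) = Σ_{ω ∈ {1,…,M}^n} |C[ω]|^s`. -/
def ZM (S : GaussLikeIFS d) (M n : ℕ) (s : ℝ) : ℝ :=
  ∑' ω : {f : Fin n → ℕ+ // ∀ j, (f j : ℕ) ≤ M}, Metric.diam (S.cyl ω.1) ^ s

/-- `P_{M,n}(s) = (1/n) log Z_{M,n}(s)`. -/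
def PMn (S : GaussLikeIFS d) (M n : ℕ) (s : ℝ) : ℝ :=
  (1 / (n : ℝ)) * Real.log (S.ZM M n s)

/-- The set `E` of points of `[0,1]` admitting a symbolic expansion `a` such that
`∏_{m=1}^k a_{n+i_m}(x)^{t_m} ≥ B^n` for infinitely many `n`.
(Digits are indexed from `0` here, i.e. `a j` is the `(j+1)`-st digit.) -/
def Eset (S : GaussLikeIFS d) (B : ℝ) {k : ℕ} (i : Fin k → ℕ) (t : Fin k → ℝ) : Set ℝ :=
  {x | x ∈ Set.Icc (0 : ℝ) 1 ∧ ∃ a : ℕ → ℕ+,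
    (∀ n : ℕ, x ∈ S.cyl (fun j : Fin n => a j.val)) ∧
    (∃ᶠ n in Filter.atTop, B ^ n ≤ ∏ m, ((a (n + i m) : ℕ) : ℝ) ^ (t m))}

end GaussLikeIFS

/-- The simplex `S = {b : b_i ≥ 0, Σ b_i t_i = 1}`. -/
def simplexS {k : ℕ} (t : Fin k → ℝ) : Set (Fin k → ℝ) :=
  {b | (∀ i, 0 ≤ b i) ∧ ∑ i, b i * t i = 1}

/-- `A_m(b,s) = (d-1)·s·b_m + (d·s-1)·Σ_{j<m} b_j`. -/
def Am (d : ℝ) {k : ℕ} (b : Fin k → ℝ) (s : ℝ) (m : Fin k) : ℝ :=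
  (d - 1) * s * b m + (d * s - 1) * ∑ j ∈ Finset.Iio m, b j

/-- `A(b,s) = max_{1 ≤ m ≤ k} A_m(b,s)`. -/
def Afun (d : ℝ) {k : ℕ} (b : Fin k → ℝ) (s : ℝ) : ℝ :=
  ⨆ m, Am d b s m

/-- `A(s) = min_{b ∈ S} A(b,s)`. -/
def AS (d : ℝ) {k : ℕ} (t : Fin k → ℝ) (s : ℝ) : ℝ :=
  sInf ((fun b => Afun d b s) '' simplexS t)

namespace GaussLikeIFS

variable {d : ℝ}

/-- The composition of the maps of the system along a list of digits. -/
def listMap (S : GaussLikeIFS d) (l : List ℕ+) (x : ℝ) : ℝ :=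
  l.foldr (fun i y => S.T i y) x

/-- The chain-rule derivative of `listMap`. -/
def listDeriv (S : GaussLikeIFS d) : List ℕ+ → ℝ → ℝ
  | [], _ => 1
  | i :: l, x => S.T' i (S.listMap l x) * S.listDeriv l x

theorem listMap_cons (S : GaussLikeIFS d) (i : ℕ+) (l : List ℕ+) (x : ℝ) :
    S.listMap (i :: l) x = S.T i (S.listMap l x) := rfl

theorem listDeriv_cons (S : GaussLikeIFS d) (i : ℕ+) (l : List ℕ+) (x : ℝ) :
    S.listDeriv (i :: l) x = S.T' i (S.listMap l x) * S.listDeriv l x := rfl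

theorem foldr_eq_listMap_listDeriv (S : GaussLikeIFS d) (l : List ℕ+) (x : ℝ) :
    l.foldr (fun i p => (S.T i p.1, S.T' i p.1 * p.2)) (x, (1 : ℝ)) =
      (S.listMap l x, S.listDeriv l x) := by
  induction l with
  | nil => rfl
  | cons i l ih => rw [List.foldr_cons, ih, listMap_cons, listDeriv_cons]

theorem chainDeriv_eq_listDeriv (S : GaussLikeIFS d) {n : ℕ} (ω : Fin n → ℕ+) (x : ℝ) :
    chainDeriv S.T S.T' ω x = S.listDeriv (List.ofFn ω) x := by
  rw [chainDeriv, foldr_eq_listMap_listDeriv]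

theorem listMap_append (S : GaussLikeIFS d) (l₁ l₂ : List ℕ+) (x : ℝ) :
    S.listMap (l₁ ++ l₂) x = S.listMap l₁ (S.listMap l₂ x) := by
  simp [listMap]

theorem listDeriv_append (S : GaussLikeIFS d) (l₁ l₂ : List ℕ+) (x : ℝ) :
    S.listDeriv (l₁ ++ l₂) x = S.listDeriv l₁ (S.listMap l₂ x) * S.listDeriv l₂ x := by
  induction l₁ with
  | nil => simp [listDeriv]
  | cons i l ih => rw [List.cons_append, listDeriv_cons, ih, listDeriv_cons, listMap_append]; ring

theorem listMap_mem (S : GaussLikeIFS d) (l : List ℕ+) {x : ℝ} (hx : x ∈ Icc (0 : ℝ) 1) :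
    S.listMap l x ∈ Icc (0 : ℝ) 1 := by
  induction l with
  | nil => exact hx
  | cons i l ih => exact S.maps_to i ih

theorem hasDerivWithinAt_listMap (S : GaussLikeIFS d) (l : List ℕ+) {x : ℝ}
    (hx : x ∈ Icc (0 : ℝ) 1) :
    HasDerivWithinAt (S.listMap l) (S.listDeriv l x) (Icc (0 : ℝ) 1) x := by
  induction l with
  | nil => exact hasDerivWithinAt_id x _
  | cons i l ih =>
    exact (S.hasDeriv i _ (S.listMap_mem l hx)).comp x ih fun y hy => S.listMap_mem l hy

/-- The logarithmic form of the decay condition. -/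
theorem exists_log_abs_deriv_bounds (S : GaussLikeIFS d) {ε : ℝ} (hε : 0 < ε) :
    ∃ k₁ k₂ : ℝ, ∀ (i : ℕ+), ∀ x ∈ Icc (0 : ℝ) 1,
      k₁ - (d + ε) * Real.log i ≤ Real.log |S.T' i x| ∧
      Real.log |S.T' i x| ≤ k₂ - (d - ε) * Real.log i := by
  obtain ⟨K₁, K₂, h₁, h₂, hK⟩ := S.decay ε hε
  refine ⟨Real.log K₁, Real.log K₂, fun i x hx => ?_⟩
  obtain ⟨ζ, lam, hb, hζ, -, hlam⟩ := hK i
  obtain ⟨hl, hu⟩ := hb x hx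
  have hi : (0 : ℝ) < ((i : ℕ) : ℝ) := by exact_mod_cast i.pos
  have hp₁ := Real.rpow_pos_of_pos hi (-(d + ε))
  have hp₂ := Real.rpow_pos_of_pos hi (-(d - ε))
  have hlow := (hζ.trans hl)
  have hT := (mul_pos h₁ hp₁).trans_le hlow
  constructor
  · have := Real.log_le_log (mul_pos h₁ hp₁) hlow
    rw [Real.log_mul h₁.ne' hp₁.ne', Real.log_rpow hi] at this
    linarith
  · have := Real.log_le_log hT (hu.trans hlam)
    rw [Real.log_mul h₂.ne' hp₂.ne', Real.log_rpow hi] at this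
    linarith

theorem deriv_ne_zero (S : GaussLikeIFS d) (i : ℕ+) {x : ℝ} (hx : x ∈ Icc (0 : ℝ) 1) :
    S.T' i x ≠ 0 := by
  obtain ⟨K₁, K₂, h₁, h₂, hK⟩ := S.decay 1 one_pos
  obtain ⟨ζ, lam, hb, hζ, -, -⟩ := hK i
  have hi : (0 : ℝ) < ((i : ℕ) : ℝ) := by exact_mod_cast i.pos
  exact abs_pos.1 ((mul_pos h₁ (Real.rpow_pos_of_pos hi _)).trans_le (hζ.trans (hb x hx).1))

theorem listDeriv_ne_zero (S : GaussLikeIFS d) (l : List ℕ+) {x : ℝ}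
    (hx : x ∈ Icc (0 : ℝ) 1) : S.listDeriv l x ≠ 0 := by
  induction l with
  | nil => exact one_ne_zero
  | cons i l ih => exact mul_ne_zero (S.deriv_ne_zero i (S.listMap_mem l hx)) ih

theorem log_abs_listDeriv_cons (S : GaussLikeIFS d) (i : ℕ+) (l : List ℕ+) {x : ℝ}
    (hx : x ∈ Icc (0 : ℝ) 1) :
    Real.log |S.listDeriv (i :: l) x| =
      Real.log |S.T' i (S.listMap l x)| + Real.log |S.listDeriv l x| := by
  rw [listDeriv_cons, abs_mul, Real.log_mul (abs_ne_zero.2 (S.deriv_ne_zero i (S.listMap_mem l hx)))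
    (abs_ne_zero.2 (S.listDeriv_ne_zero l hx))]

theorem exists_log_abs_deriv_le (S : GaussLikeIFS d) :
    ∃ C : ℝ, 0 ≤ C ∧ ∀ (i : ℕ+), ∀ x ∈ Icc (0 : ℝ) 1,
      Real.log |S.T' i x| ≤ C - (1 / 2) * Real.log i := by
  obtain ⟨_, k, hk⟩ := S.exists_log_abs_deriv_bounds (ε := 1 / 2) (by norm_num)
  refine ⟨max k 0, le_max_right _ _, fun i x hx => ?_⟩
  have hlog : 0 ≤ Real.log i := Real.log_natCast_nonneg _
  have := (hk i x hx).2
  have := S.one_lt_d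
  have := le_max_left k 0
  nlinarith

/-- Derivatives along words decay exponentially in the length of the word. -/
theorem exists_log_abs_listDeriv_le (S : GaussLikeIFS d) :
    ∃ C c : ℝ, 0 ≤ C ∧ 0 < c ∧ ∀ (l : List ℕ+), ∀ x ∈ Icc (0 : ℝ) 1,
      Real.log |S.listDeriv l x| ≤ C - c * l.length := by
  obtain ⟨B, hB, hT⟩ := S.exists_log_abs_deriv_le
  obtain ⟨m, h, hm, h₀, h₁, hS⟩ := S.contracting
  have hm' : (0 : ℝ) < m := by exact_mod_cast hm
  have hc : 0 < -Real.log h / m := div_pos (neg_pos.2 (Real.log_neg h₀ h₁)) hm'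
  set c := -Real.log h / m with hcdef
  have hcm : c * m = -Real.log h := div_mul_cancel₀ _ hm'.ne'
  have trivial_bound : ∀ (l : List ℕ+), ∀ x ∈ Icc (0 : ℝ) 1,
      Real.log |S.listDeriv l x| ≤ B * l.length := by
    intro l x hx
    induction l with
    | nil => simp [listDeriv]
    | cons i l ih =>
      rw [S.log_abs_listDeriv_cons i l hx, List.length_cons]
      have := hT i _ (S.listMap_mem l hx)
      have : 0 ≤ Real.log i := Real.log_natCast_nonneg _
      push_cast
      linarith
  have block_bound : ∀ (l : List ℕ+), l.length = m → ∀ x ∈ Icc (0 : ℝ) 1,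
      Real.log |S.listDeriv l x| ≤ -(c * m) := by
    rintro l rfl x hx
    have := hS l.get x hx
    rw [chainDeriv_eq_listDeriv, List.ofFn_get] at this
    rw [hcm, neg_neg]
    exact Real.log_le_log this.1 this.2
  refine ⟨(B + c) * m, c, by positivity, hc, fun l => ?_⟩
  induction hn : l.length using Nat.strong_induction_on generalizing l with
  | _ n ih =>
    intro x hx
    rcases lt_or_ge n m with hlt | hge
    · have h := trivial_bound l x hx
      have hnm : (n : ℝ) ≤ m := by exact_mod_cast hlt.le
      rw [hn] at h
      nlinarith
    · have hdrop : (l.drop m).length = n - m := by rw [List.length_drop, hn]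
      have htake : (l.take m).length = m := by rw [List.length_take, hn, min_eq_left hge]
      have hd := ih (n - m) (by omega) (l.drop m) hdrop x hx
      have hy := S.listMap_mem (l.drop m) hx
      have ht := block_bound (l.take m) htake _ hy
      rw [← List.take_append_drop m l, listDeriv_append, abs_mul,
        Real.log_mul (abs_ne_zero.2 (S.listDeriv_ne_zero _ hy))
          (abs_ne_zero.2 (S.listDeriv_ne_zero _ hx))]
      rw [Nat.cast_sub hge] at hd
      linarith

theorem exists_forall_abs_listMap_sub_lt (S : GaussLikeIFS d) {r : ℝ} (hr : 0 < r) :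
    ∃ N : ℕ, ∀ l : List ℕ+, N ≤ l.length → ∀ x ∈ Icc (0 : ℝ) 1, ∀ y ∈ Icc (0 : ℝ) 1,
      |S.listMap l x - S.listMap l y| < r := by
  obtain ⟨C, c, -, hc, hD⟩ := S.exists_log_abs_listDeriv_le
  obtain ⟨N, hN⟩ := exists_nat_gt ((C - Real.log r) / c)
  refine ⟨N, fun l hl x hx y hy => ?_⟩
  have hl' : (N : ℝ) ≤ l.length := by exact_mod_cast hl
  have hexp : Real.exp (C - c * l.length) < r := by
    rw [← Real.lt_log_iff_exp_lt hr]
    rw [div_lt_iff₀ hc] at hN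
    nlinarith
  have hbound : ∀ z ∈ Icc (0 : ℝ) 1, ‖S.listDeriv l z‖ ≤ Real.exp (C - c * l.length) :=
    fun z hz => (Real.log_le_iff_le_exp (abs_pos.2 (S.listDeriv_ne_zero l hz))).1 (hD l z hz)
  have hmv := (convex_Icc (0 : ℝ) 1).norm_image_sub_le_of_norm_hasDerivWithin_le
    (fun z hz => S.hasDerivWithinAt_listMap l hz) hbound hy hx
  have hxy : ‖x - y‖ ≤ 1 := by
    rw [Real.norm_eq_abs, abs_le]
    constructor <;> linarith [hx.1, hx.2, hy.1, hy.2]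
  rw [Real.norm_eq_abs] at hmv
  have := mul_le_of_le_one_right (Real.exp_pos (C - c * l.length)).le hxy
  linarith

/-- For a finite set of digits, the functions `log |T_i'|` are uniformly equicontinuous. -/
theorem exists_forall_lt_abs_log_abs_deriv_sub_lt (S : GaussLikeIFS d) (M : ℕ) {η : ℝ}
    (hη : 0 < η) :
    ∃ r > 0, ∀ i : ℕ+, (i : ℕ) < M → ∀ u ∈ Icc (0 : ℝ) 1, ∀ v ∈ Icc (0 : ℝ) 1, |u - v| < r →
      |(Real.log |S.T' i u| - Real.log |S.T' i v|)| < η := by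
  have single : ∀ i : ℕ+, ∃ r > 0, ∀ u ∈ Icc (0 : ℝ) 1, ∀ v ∈ Icc (0 : ℝ) 1, |u - v| < r →
      |(Real.log |S.T' i u| - Real.log |S.T' i v|)| < η := fun i =>
    Metric.uniformContinuousOn_iff.1 (isCompact_Icc.uniformContinuousOn_of_continuous
      ((S.derivCont i).abs.log fun x hx => abs_ne_zero.2 (S.deriv_ne_zero i hx))) η hη
  choose r hr h using single
  induction M with
  | zero => exact ⟨1, one_pos, fun i hi => absurd hi (Nat.not_lt_zero _)⟩
  | succ M ih =>
    obtain ⟨r', hr', h'⟩ := ih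
    rcases Nat.eq_zero_or_pos M with rfl | hM
    · exact ⟨1, one_pos, fun i hi => absurd i.pos (by omega)⟩
    · refine ⟨min r' (r ⟨M, hM⟩), lt_min hr' (hr _), fun i hi u hu v hv huv => ?_⟩
      rcases Nat.lt_succ_iff_lt_or_eq.1 hi with hlt | heq
      · exact h' i hlt u hu v hv (huv.trans_le (min_le_left _ _))
      · obtain rfl : i = ⟨M, hM⟩ := PNat.eq heq
        exact h _ u hu v hv (huv.trans_le (min_le_right _ _))

/-- Distortion of the individual maps, relative to the size of the logarithmic derivative. -/
theorem exists_abs_log_abs_deriv_sub_le (S : GaussLikeIFS d) :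
    ∃ C : ℝ, 0 ≤ C ∧ ∀ ε : ℝ, 0 < ε → ∃ r D : ℝ, 0 < r ∧ 0 ≤ D ∧
      ∀ i : ℕ+, ∀ u ∈ Icc (0 : ℝ) 1, ∀ v ∈ Icc (0 : ℝ) 1,
        |(Real.log |S.T' i u| - Real.log |S.T' i v|)| ≤ D + ε * (C - Real.log |S.T' i u|) ∧
        (|u - v| < r →
          |(Real.log |S.T' i u| - Real.log |S.T' i v|)| ≤ ε * (C - Real.log |S.T' i u|)) := by
  obtain ⟨B, hB, hT⟩ := S.exists_log_abs_deriv_le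
  refine ⟨B + 1, by positivity, fun ε hε => ?_⟩
  obtain ⟨k₁, k₂, hk⟩ := S.exists_log_abs_deriv_bounds (ε := ε / 8) (by positivity)
  obtain ⟨M, hM⟩ := exists_nat_gt (Real.exp (4 * |k₂ - k₁| / ε))
  obtain ⟨r, hr, hunif⟩ := S.exists_forall_lt_abs_log_abs_deriv_sub_lt M hε
  refine ⟨r, |k₂ - k₁|, hr, abs_nonneg _, fun i u hu v hv => ?_⟩
  have hlog : 0 ≤ Real.log i := Real.log_natCast_nonneg _
  have hsize := mul_le_mul_of_nonneg_left (hT i u hu) hε.le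
  have hεlog := mul_nonneg hε.le hlog
  have hosc : |(Real.log |S.T' i u| - Real.log |S.T' i v|)| ≤
      |k₂ - k₁| + ε / 4 * Real.log i := by
    have hu' := hk i u hu
    have hv' := hk i v hv
    have := le_abs_self (k₂ - k₁)
    rw [abs_le]
    constructor <;> linarith
  refine ⟨by linarith, fun huv => ?_⟩
  rcases lt_or_ge (i : ℕ) M with hlt | hge
  · linarith [hunif i hlt u hu v hv huv]
  · have hMi : (M : ℝ) ≤ ((i : ℕ) : ℝ) := by exact_mod_cast hge
    have hlarge : 4 * |k₂ - k₁| / ε ≤ Real.log i :=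
      (Real.le_log_iff_exp_le (by exact_mod_cast i.pos)).2 (hM.le.trans hMi)
    rw [div_le_iff₀ hε] at hlarge
    linarith

end GaussLikeIFS

/-- every `d`-decaying Gauss-like IFS satisfies Almost Tempered Distortion:
for every `ε > 0` there is a sublinear `ρ` with
`|log|T_ω'(x)| − log|T_ω'(y)|| ≤ ρ(n) + ε·|log|T_ω'(x)||`. -/
theorem almost_tempered_distortion {d : ℝ} (S : GaussLikeIFS d) :
    ∀ ε : ℝ, 0 < ε → ∃ ρ : ℕ → ℝ, (∀ n, 0 ≤ ρ n) ∧
      Filter.Tendsto (fun n : ℕ => ρ n / n) Filter.atTop (nhds 0) ∧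
      ∀ (n : ℕ) (ω : Fin n → ℕ+), ∀ x ∈ Set.Icc (0 : ℝ) 1, ∀ y ∈ Set.Icc (0 : ℝ) 1,
        abs (Real.log (abs (chainDeriv S.T S.T' ω x)) -
            Real.log (abs (chainDeriv S.T S.T' ω y))) ≤
          ρ n + ε * abs (Real.log (abs (chainDeriv S.T S.T' ω x))) := by
  intro ε hε
  obtain ⟨C₁, hC₁, hdist⟩ := S.exists_abs_log_abs_deriv_sub_le
  obtain ⟨C, c, hC, hc, hdecay⟩ := S.exists_log_abs_listDeriv_le
  have hpos : 0 < C₁ / c + 1 := by positivity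
  set δ := ε / (C₁ / c + 1) with hδdef
  have hδ : 0 < δ := div_pos hε hpos
  have hδε : δ * (C₁ / c + 1) = ε := div_mul_cancel₀ _ hpos.ne'
  obtain ⟨r, D, hr, hD, hosc⟩ := hdist δ hδ
  obtain ⟨N, hN⟩ := S.exists_forall_abs_listMap_sub_lt hr
  have key : ∀ l : List ℕ+, ∀ x ∈ Icc (0 : ℝ) 1, ∀ y ∈ Icc (0 : ℝ) 1,
      |(Real.log |S.listDeriv l x| - Real.log |S.listDeriv l y|)| ≤
        D * (min l.length N : ℕ) + δ * (C₁ * l.length - Real.log |S.listDeriv l x|) := by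
    intro l x hx y hy
    induction l with
    | nil => simp [GaussLikeIFS.listDeriv]
    | cons i l ih =>
      rw [S.log_abs_listDeriv_cons i l hx, S.log_abs_listDeriv_cons i l hy, List.length_cons,
        add_sub_add_comm]
      refine (abs_add_le _ _).trans ?_
      obtain ⟨hfar, hnear⟩ := hosc i _ (S.listMap_mem l hx) _ (S.listMap_mem l hy)
      rcases lt_or_ge l.length N with hlt | hge
      · rw [min_eq_left hlt.le] at ih
        rw [min_eq_left (Nat.succ_le_of_lt hlt)]
        push_cast
        linarith
      · have := hnear (hN l hge x hx y hy)
        rw [min_eq_right hge] at ih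
        rw [min_eq_right (hge.trans (Nat.le_succ _))]
        push_cast
        linarith
  refine ⟨fun _ => D * N + δ * (C₁ / c * C), fun _ => by positivity,
    tendsto_const_div_atTop_nhds_zero_nat _, fun n ω x hx y hy => ?_⟩
  rw [S.chainDeriv_eq_listDeriv, S.chainDeriv_eq_listDeriv]
  refine (key _ x hx y hy).trans ?_
  have hlen := hdecay (List.ofFn ω) x hx
  set l := List.ofFn ω
  set L := Real.log |S.listDeriv l x|
  have hmin : D * (min l.length N : ℕ) ≤ D * N :=
    mul_le_mul_of_nonneg_left (by exact_mod_cast min_le_right _ _) hD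
  have hL : -L ≤ |L| := neg_le_abs L
  have hlen' : C₁ * l.length ≤ C₁ / c * (C + |L|) := by
    have := mul_le_mul_of_nonneg_left (show c * l.length ≤ C + |L| by linarith)
      (div_nonneg hC₁ hc.le)
    rwa [← mul_assoc, div_mul_cancel₀ _ hc.ne'] at this
  have := mul_le_mul_of_nonneg_left (add_le_add hlen' hL) hδ.le
  rw [← hδε]
  linarith
end
end

section
/- Let {T_n}_{n≥1} be a d-decaying Gauss-like iterated function system and fix M ∈ ℕ. Then the system restricted to the symbols {1,…,M} satisfies Tempered Distortion: there exists a function ρ : ℕ → [0,∞) with ρ(n)/n → 0 such that for all n ∈ ℕ, all ω = (a_1,…,a_n) ∈ {1,…,M}^n, and all x, y ∈ [0,1], writing T_ω = T_{a_1}∘⋯∘T_{a_n}, one has e^{−ρ(n)} ≤ |T_ω'(x)| / |T_ω'(y)| ≤ e^{ρ(n)}. -/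
open Set Filter Topology Metric MeasureTheory

noncomputable section

/-- The composition of the maps `T i` along a list of symbols. -/
def wordMap (T : ℕ+ → ℝ → ℝ) (l : List ℕ+) (x : ℝ) : ℝ :=
  l.foldr (fun i y => T i y) x

/-- The chain-rule derivative of `wordMap T l`. -/
def wordDeriv (T T' : ℕ+ → ℝ → ℝ) (l : List ℕ+) (x : ℝ) : ℝ :=
  (l.foldr (fun i p => (T i p.1, T' i p.1 * p.2)) (x, (1 : ℝ))).2

theorem wordMap_append (T : ℕ+ → ℝ → ℝ) (l₁ l₂ : List ℕ+) (x : ℝ) :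
    wordMap T (l₁ ++ l₂) x = wordMap T l₁ (wordMap T l₂ x) :=
  List.foldr_append

theorem wordDeriv_cons (T T' : ℕ+ → ℝ → ℝ) (i : ℕ+) (l : List ℕ+) (x : ℝ) :
    wordDeriv T T' (i :: l) x = T' i (wordMap T l x) * wordDeriv T T' l x := by
  have h : ∀ l : List ℕ+,
      (l.foldr (fun i p => (T i p.1, T' i p.1 * p.2)) (x, (1 : ℝ))).1 = wordMap T l x := by
    intro l
    induction l with
    | nil => rfl
    | cons j l ih => exact congrArg (T j) ih
  exact congrArg (fun z => T' i z * wordDeriv T T' l x) (h l)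

/-- A continuous function on `[0,1]` has oscillation tending to `0` along any sequence of
scales tending to `0`. -/
theorem exists_modulus_of_continuousOn {f : ℝ → ℝ} (hf : ContinuousOn f (Icc 0 1))
    {δ : ℕ → ℝ} (hδ : Tendsto δ atTop (𝓝 0)) :
    ∃ η : ℕ → ℝ, (∀ k, 0 ≤ η k) ∧ Tendsto η atTop (𝓝 0) ∧
      ∀ k, ∀ x ∈ Icc (0 : ℝ) 1, ∀ y ∈ Icc (0 : ℝ) 1, |x - y| ≤ δ k → |f x - f y| ≤ η k := by
  obtain ⟨C, hC⟩ := isCompact_Icc.exists_bound_of_continuousOn hf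
  let A : ℕ → Set ℝ := fun k =>
    {r | ∃ x ∈ Icc (0 : ℝ) 1, ∃ y ∈ Icc (0 : ℝ) 1, |x - y| ≤ δ k ∧ r = |f x - f y|}
  have hA : ∀ k, BddAbove (A k) := by
    rintro k
    refine ⟨C + C, ?_⟩
    rintro r ⟨x, hx, y, hy, -, rfl⟩
    exact (abs_sub _ _).trans (add_le_add (hC x hx) (hC y hy))
  have hnonneg : ∀ k, 0 ≤ sSup (A k) := by
    intro k
    apply Real.sSup_nonneg
    rintro r ⟨x, -, y, -, -, rfl⟩
    exact abs_nonneg _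
  refine ⟨fun k => sSup (A k), hnonneg, ?_, fun k x hx y hy h =>
    le_csSup (hA k) ⟨x, hx, y, hy, h, rfl⟩⟩
  rw [Metric.tendsto_atTop]
  intro ε hε
  obtain ⟨r, hr, hfr⟩ := Metric.uniformContinuousOn_iff.1
    (isCompact_Icc.uniformContinuousOn_of_continuous hf) (ε / 2) (half_pos hε)
  obtain ⟨N, hN⟩ := Metric.tendsto_atTop.1 hδ r hr
  refine ⟨N, fun n hn => ?_⟩
  rw [Real.dist_eq, sub_zero, abs_of_nonneg (hnonneg n)]
  refine lt_of_le_of_lt (Real.sSup_le ?_ (half_pos hε).le) (half_lt_self hε)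
  rintro _ ⟨x, hx, y, hy, hxy, rfl⟩
  have hn' := hN n hn
  rw [Real.dist_eq, sub_zero] at hn'
  exact (hfr x hx y hy (hxy.trans_lt ((le_abs_self _).trans_lt hn'))).le

namespace GaussLikeIFS

variable {d : ℝ}

theorem wordMap_mem (S : GaussLikeIFS d) (l : List ℕ+) {x : ℝ} (hx : x ∈ Icc (0 : ℝ) 1) :
    wordMap S.T l x ∈ Icc (0 : ℝ) 1 := by
  induction l with
  | nil => exact hx
  | cons i l ih => exact S.maps_to i ih

theorem wordDeriv_ne_zero (S : GaussLikeIFS d) (l : List ℕ+) {x : ℝ}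
    (hx : x ∈ Icc (0 : ℝ) 1) : wordDeriv S.T S.T' l x ≠ 0 := by
  induction l with
  | nil => exact one_ne_zero
  | cons i l ih =>
    rw [wordDeriv_cons]
    exact mul_ne_zero (S.deriv_ne_zero i (S.wordMap_mem l hx)) ih

theorem hasDerivWithinAt_wordMap (S : GaussLikeIFS d) (l : List ℕ+) {x : ℝ}
    (hx : x ∈ Icc (0 : ℝ) 1) :
    HasDerivWithinAt (wordMap S.T l) (wordDeriv S.T S.T' l x) (Icc 0 1) x := by
  induction l with
  | nil => exact hasDerivWithinAt_id x _
  | cons i l ih =>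
    rw [wordDeriv_cons]
    exact (S.hasDeriv i _ (S.wordMap_mem l hx)).comp x ih fun y hy => S.wordMap_mem l hy

/-- Cylinders of a Gauss-like system shrink to points uniformly in the length of the word. -/
theorem exists_cylinder_bound (S : GaussLikeIFS d) :
    ∃ δ : ℕ → ℝ, Tendsto δ atTop (𝓝 0) ∧ ∀ l : List ℕ+, ∀ x ∈ Icc (0 : ℝ) 1,
      ∀ y ∈ Icc (0 : ℝ) 1, |wordMap S.T l x - wordMap S.T l y| ≤ δ l.length := by
  obtain ⟨m, h, hm, h0, h1, hc⟩ := S.contracting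
  have hblock : ∀ l : List ℕ+, l.length = m → ∀ x ∈ Icc (0 : ℝ) 1, ∀ y ∈ Icc (0 : ℝ) 1,
      |wordMap S.T l x - wordMap S.T l y| ≤ h * |x - y| := by
    intro l hl x hx y hy
    subst hl
    refine (convex_Icc (0 : ℝ) 1).norm_image_sub_le_of_norm_hasDerivWithin_le
      (fun z hz => S.hasDerivWithinAt_wordMap l hz) (fun z hz => ?_) hy hx
    have := (hc l.get z hz).2
    rwa [chainDeriv, List.ofFn_get] at this
  have hpow : ∀ (q : ℕ) (l : List ℕ+), q * m ≤ l.length → ∀ x ∈ Icc (0 : ℝ) 1,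
      ∀ y ∈ Icc (0 : ℝ) 1, |wordMap S.T l x - wordMap S.T l y| ≤ h ^ q := by
    intro q
    induction q with
    | zero =>
      intro l _ x hx y hy
      have hx' := S.wordMap_mem l hx
      have hy' := S.wordMap_mem l hy
      rw [pow_zero, abs_le]
      constructor <;> linarith [hx'.1, hx'.2, hy'.1, hy'.2]
    | succ q ih =>
      intro l hl x hx y hy
      rw [add_mul, one_mul] at hl
      rw [← List.take_append_drop m l, wordMap_append, wordMap_append, pow_succ']
      refine (hblock _ (List.length_take_of_le (by omega)) _ (S.wordMap_mem _ hx) _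
        (S.wordMap_mem _ hy)).trans (mul_le_mul_of_nonneg_left (ih _ ?_ x hx y hy) h0.le)
      rw [List.length_drop]
      omega
  exact ⟨fun k => h ^ (k / m),
    (tendsto_pow_atTop_nhds_zero_of_lt_one h0.le h1).comp (Nat.tendsto_div_const_atTop hm.ne'),
    fun l => hpow _ l (Nat.div_mul_le_self _ _)⟩

/-- The logarithms of the derivatives of the first `M` maps have a common modulus of continuity
along cylinders. -/
theorem exists_log_deriv_modulus (S : GaussLikeIFS d) (M : ℕ) :
    ∃ η : ℕ → ℝ, (∀ k, 0 ≤ η k) ∧ Tendsto η atTop (𝓝 0) ∧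
      ∀ (i : ℕ+) (l : List ℕ+), (i : ℕ) ≤ M → ∀ x ∈ Icc (0 : ℝ) 1, ∀ y ∈ Icc (0 : ℝ) 1,
        |Real.log (S.T' i (wordMap S.T l x)) - Real.log (S.T' i (wordMap S.T l y))|
          ≤ η l.length := by
  obtain ⟨δ, hδ, hl⟩ := S.exists_cylinder_bound
  choose η h0 hη hmod using fun i : ℕ+ => exists_modulus_of_continuousOn
    ((S.derivCont i).log fun x hx => S.deriv_ne_zero i hx) hδ
  let s : Finset ℕ+ := Finset.Icc 1 M.succPNat
  refine ⟨fun k => ∑ i ∈ s, η i k, fun k => Finset.sum_nonneg fun i _ => h0 i k, ?_, ?_⟩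
  · simpa using tendsto_finsetSum s fun i _ => hη i
  · intro i l hi x hx y hy
    have his : i ∈ s := Finset.mem_Icc.2
      ⟨one_le, PNat.coe_le_coe _ _ |>.1 (hi.trans (Nat.le_succ M))⟩
    exact (hmod i _ _ (S.wordMap_mem l hx) _ (S.wordMap_mem l hy) (hl l x hx y hy)).trans
      (Finset.single_le_sum (f := fun j => η j l.length) (fun j _ => h0 j _) his)

theorem abs_log_wordDeriv_sub_le (S : GaussLikeIFS d) {M : ℕ} {η : ℕ → ℝ}
    (hη : ∀ (i : ℕ+) (l : List ℕ+), (i : ℕ) ≤ M → ∀ x ∈ Icc (0 : ℝ) 1, ∀ y ∈ Icc (0 : ℝ) 1,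
      |Real.log (S.T' i (wordMap S.T l x)) - Real.log (S.T' i (wordMap S.T l y))| ≤ η l.length)
    {x y : ℝ} (hx : x ∈ Icc (0 : ℝ) 1) (hy : y ∈ Icc (0 : ℝ) 1) (l : List ℕ+)
    (hl : ∀ i ∈ l, (i : ℕ) ≤ M) :
    |Real.log (wordDeriv S.T S.T' l x) - Real.log (wordDeriv S.T S.T' l y)|
      ≤ ∑ k ∈ Finset.range l.length, η k := by
  induction l with
  | nil => simp [wordDeriv]
  | cons i l ih =>
    rw [wordDeriv_cons, wordDeriv_cons,
      Real.log_mul (S.deriv_ne_zero i (S.wordMap_mem l hx)) (S.wordDeriv_ne_zero l hx),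
      Real.log_mul (S.deriv_ne_zero i (S.wordMap_mem l hy)) (S.wordDeriv_ne_zero l hy),
      List.length_cons, Finset.sum_range_succ, add_sub_add_comm, add_comm (Finset.sum _ _)]
    exact (abs_add_le _ _).trans (add_le_add
      (hη i l (hl i List.mem_cons_self) x hx y hy)
      (ih fun j hj => hl j (List.mem_cons_of_mem i hj)))

end GaussLikeIFS

/-- the system restricted to the symbols `{1,…,M}` satisfies
Tempered Distortion. -/
theorem tempered_distortion_restricted {d : ℝ} (S : GaussLikeIFS d) (M : ℕ) :
    ∃ ρ : ℕ → ℝ, (∀ n, 0 ≤ ρ n) ∧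
      Filter.Tendsto (fun n : ℕ => ρ n / n) Filter.atTop (nhds 0) ∧
      ∀ (n : ℕ) (ω : Fin n → ℕ+), (∀ j, (ω j : ℕ) ≤ M) →
        ∀ x ∈ Set.Icc (0 : ℝ) 1, ∀ y ∈ Set.Icc (0 : ℝ) 1,
          Real.exp (-ρ n) ≤ |chainDeriv S.T S.T' ω x| / |chainDeriv S.T S.T' ω y| ∧
          |chainDeriv S.T S.T' ω x| / |chainDeriv S.T S.T' ω y| ≤ Real.exp (ρ n) := by
  obtain ⟨η, h0, hlim, hη⟩ := S.exists_log_deriv_modulus M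
  refine ⟨fun n => ∑ k ∈ Finset.range n, η k, fun n => Finset.sum_nonneg fun k _ => h0 k, ?_, ?_⟩
  · simpa only [div_eq_inv_mul] using hlim.cesaro
  · intro n ω hω x hx y hy
    have hmem : ∀ i ∈ List.ofFn ω, (i : ℕ) ≤ M := by
      intro i hi
      obtain ⟨j, rfl⟩ := List.mem_ofFn.1 hi
      exact hω j
    have hlog := S.abs_log_wordDeriv_sub_le hη hx hy (List.ofFn ω) hmem
    have hX : chainDeriv S.T S.T' ω x ≠ 0 := S.wordDeriv_ne_zero _ hx
    have hY : chainDeriv S.T S.T' ω y ≠ 0 := S.wordDeriv_ne_zero _ hy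
    change |Real.log (chainDeriv S.T S.T' ω x) - Real.log (chainDeriv S.T S.T' ω y)| ≤ _ at hlog
    rw [List.length_ofFn, ← Real.log_div hX hY, ← Real.log_abs, abs_le] at hlog
    have hpos : 0 < |chainDeriv S.T S.T' ω x / chainDeriv S.T S.T' ω y| :=
      abs_pos.2 (div_ne_zero hX hY)
    rw [← abs_div]
    exact ⟨(Real.le_log_iff_exp_le hpos).1 hlog.1, (Real.log_le_iff_le_exp hpos).1 hlog.2⟩
end
end
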